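/- arXiv:2505.05146 — 2 statements merged into one kernel-verified Lean document; each statement's English description precedes it below -/
import Mathlib

section
/- Let n ≥ 1 be an integer, let H : ℝ³ → ℝ be a harmonic polynomial (ΔH = 0) that is homogeneous of degree n, and let Ψ : [1,∞) → ℝ be a C² function satisfying (1 − s²) Ψ''(s) + n(n+1) Ψ(s) = 0 for s > 1 and Ψ(1) = 0. Then the function φ(x,t) = Ψ(t/|x|) · H(x/|x|), defined for t ≥ |x| > 0, satisfies the wave equation ∂ₜₜφ − Δφ = 0 for t > |x| > 0 and vanishes on the light cone: φ(x,|x|) = 0 for x ≠ 0. -/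
noncomputable section

/-- The spatial Laplacian of `f : ℝ³ → ℝ` at `x`. -/
def lap3 (f : EuclideanSpace ℝ (Fin 3) → ℝ) (x : EuclideanSpace ℝ (Fin 3)) : ℝ :=
  ∑ k : Fin 3, iteratedDeriv 2 (fun s : ℝ => f (x + s • EuclideanSpace.single k (1:ℝ))) 0

open Filter Topology

/-- `f` is differentiable near `a`, with `f' a = f₁`, and twice differentiable at `a`, with
`f'' a = f₂`. -/
def HasSecondDerivAt (f : ℝ → ℝ) (f₁ f₂ a : ℝ) : Prop :=
  ∃ f' : ℝ → ℝ, (∀ᶠ s in 𝓝 a, HasDerivAt f (f' s) s) ∧ f' a = f₁ ∧ HasDerivAt f' f₂ a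

namespace HasSecondDerivAt

variable {f g : ℝ → ℝ} {f₁ f₂ g₁ g₂ a : ℝ}

lemma hasDerivAt (hf : HasSecondDerivAt f f₁ f₂ a) : HasDerivAt f f₁ a := by
  obtain ⟨f', h, rfl, -⟩ := hf
  exact h.self_of_nhds

lemma iteratedDeriv_two (hf : HasSecondDerivAt f f₁ f₂ a) : iteratedDeriv 2 f a = f₂ := by
  obtain ⟨f', h, -, h₂⟩ := hf
  rw [iteratedDeriv_succ, iteratedDeriv_one]
  exact (h₂.congr_of_eventuallyEq (h.mono fun s hs => hs.deriv)).deriv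

lemma mul (hf : HasSecondDerivAt f f₁ f₂ a) (hg : HasSecondDerivAt g g₁ g₂ a) :
    HasSecondDerivAt (fun s => f s * g s) (f₁ * g a + f a * g₁)
      (f₂ * g a + 2 * f₁ * g₁ + f a * g₂) a := by
  have hf₀ := hf.hasDerivAt
  have hg₀ := hg.hasDerivAt
  obtain ⟨f', h, rfl, h₂⟩ := hf
  obtain ⟨g', k, rfl, k₂⟩ := hg
  refine ⟨fun s => f' s * g s + f s * g' s, ?_, rfl, ?_⟩
  · filter_upwards [h, k] with s hs ks using hs.mul ks
  · exact ((h₂.mul hg₀).add (hf₀.mul k₂)).congr_deriv (by ring)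

lemma comp (hg : HasSecondDerivAt g g₁ g₂ (f a)) (hf : HasSecondDerivAt f f₁ f₂ a) :
    HasSecondDerivAt (fun s => g (f s)) (g₁ * f₁) (g₂ * f₁ ^ 2 + g₁ * f₂) a := by
  have hf₀ := hf.hasDerivAt
  obtain ⟨f', h, rfl, h₂⟩ := hf
  obtain ⟨g', k, rfl, k₂⟩ := hg
  refine ⟨fun s => g' (f s) * f' s, ?_, rfl, ?_⟩
  · filter_upwards [h, hf₀.continuousAt.eventually k] with s hs ks using ks.comp s hs
  · exact ((k₂.comp a hf₀).mul h₂).congr_deriv (by simp only [Function.comp_apply]; ring)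

lemma zpow (m : ℤ) (ha : a ≠ 0) :
    HasSecondDerivAt (fun s => s ^ m) (m * a ^ (m - 1)) (m * ((m - 1) * a ^ (m - 2))) a := by
  refine ⟨fun s => m * s ^ (m - 1), ?_, rfl, ?_⟩
  · filter_upwards [isOpen_ne.mem_nhds ha] with s hs using hasDerivAt_zpow m s (Or.inl hs)
  · refine ((hasDerivAt_zpow (m - 1) a (Or.inl ha)).const_mul (m : ℝ)).congr_deriv ?_
    rw [sub_sub]
    push_cast
    norm_num

lemma sqrt (ha : 0 < a) :
    HasSecondDerivAt Real.sqrt (1 / (2 * √a)) (-(1 / (4 * √a ^ 3))) a := by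
  have hs : 0 < √a := Real.sqrt_pos.2 ha
  refine ⟨fun s => 1 / (2 * √s), ?_, rfl, ?_⟩
  · filter_upwards [lt_mem_nhds ha] with s hs using Real.hasDerivAt_sqrt hs.ne'
  · have := ((Real.hasDerivAt_sqrt ha.ne').const_mul 2).inv (by positivity)
    simp only [one_div]
    refine this.congr_deriv ?_
    field_simp
    norm_num

lemma const_mul_id (c : ℝ) : HasSecondDerivAt (fun s => c * s) c 0 a :=
  ⟨fun _ => c, .of_forall fun s => by simpa using (hasDerivAt_id s).const_mul c, rfl,
    hasDerivAt_const _ _⟩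

lemma const (c : ℝ) : HasSecondDerivAt (fun _ => c) 0 0 a :=
  ⟨fun _ => 0, .of_forall fun _ => hasDerivAt_const _ _, rfl, hasDerivAt_const _ _⟩

end HasSecondDerivAt

lemma ContDiffAt.hasSecondDerivAt {f : ℝ → ℝ} {a : ℝ} (hf : ContDiffAt ℝ 2 f a) :
    HasSecondDerivAt f (deriv f a) (deriv (deriv f) a) a := by
  refine ⟨deriv f, ?_, rfl, ?_⟩
  · filter_upwards [hf.eventually (by simp)] with s hs
    exact (hs.differentiableAt (by norm_num)).hasDerivAt
  · have h : ContDiffAt ℝ 1 (fun s => fderiv ℝ f s 1) a :=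
      (hf.fderiv_right (m := 1) (by norm_num)).clm_apply contDiffAt_const
    exact (h.differentiableAt (by norm_num)).hasDerivAt

lemma MvPolynomial.IsHomogeneous.eval_smul' {σ : Type*} {n : ℕ} {P : MvPolynomial σ ℝ}
    (hP : P.IsHomogeneous n) (c : ℝ) (x : σ → ℝ) : eval (c • x) P = c ^ n * eval x P := by
  rw [eval_eq, eval_eq, Finset.mul_sum]
  refine Finset.sum_congr rfl fun d hd => ?_
  have hd' : ∑ i ∈ d.support, d i = n := by
    have := hP (mem_support_iff.1 hd)
    simpa [Finsupp.weight_apply, Finsupp.sum] using this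
  simp only [Pi.smul_apply, smul_eq_mul, mul_pow, Finset.prod_mul_distrib,
    Finset.prod_pow_eq_pow_sum, hd']
  ring

lemma contDiff_eval_mvPolynomial {m : ℕ} (P : MvPolynomial (Fin m) ℝ) :
    ContDiff ℝ 2 fun x : EuclideanSpace ℝ (Fin m) => MvPolynomial.eval x P := by
  have h : AnalyticOnNhd ℝ (fun x : EuclideanSpace ℝ (Fin m) => MvPolynomial.eval x P) Set.univ :=
    AnalyticOnNhd.eval_continuousLinearMap (EuclideanSpace.equiv (Fin m) ℝ).toContinuousLinearMap P
  exact contDiffOn_univ.1 h.contDiffOn_of_completeSpace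

/-- Euler's identity for homogeneous functions. -/
lemma sum_coord_mul_fderiv_single {m n : ℕ} {H : EuclideanSpace ℝ (Fin m) → ℝ}
    {x : EuclideanSpace ℝ (Fin m)} (hH : DifferentiableAt ℝ H x)
    (hhom : ∀ c : ℝ, H (c • x) = c ^ n * H x) :
    ∑ k, x k * fderiv ℝ H x (EuclideanSpace.single k 1) = n * H x := by
  have hx : ∑ k, x k • EuclideanSpace.single k (1 : ℝ) = x := by
    ext i
    simp [Pi.single_apply]
  have h₁ : HasDerivAt (fun c : ℝ => H (c • x)) (fderiv ℝ H x x) 1 := by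
    have hid : HasDerivAt (fun c : ℝ => c • x) x 1 := by
      simpa using (hasDerivAt_id (1 : ℝ)).smul_const x
    have hH' : HasFDerivAt H (fderiv ℝ H x) ((1 : ℝ) • x) := by
      simpa using hH.hasFDerivAt
    exact hH'.comp_hasDerivAt 1 hid
  have h₂ : HasDerivAt (fun c : ℝ => H (c • x)) (n * H x) 1 := by
    simp only [hhom]
    simpa using (hasDerivAt_pow n (1 : ℝ)).mul_const (H x)
  calc ∑ k, x k * fderiv ℝ H x (EuclideanSpace.single k 1)
      = fderiv ℝ H x (∑ k, x k • EuclideanSpace.single k (1 : ℝ)) := by simp [map_sum]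
    _ = n * H x := by rw [hx, h₁.unique h₂]

lemma norm_add_smul_single {m : ℕ} (x : EuclideanSpace ℝ (Fin m)) (k : Fin m) (s : ℝ) :
    ‖x + s • EuclideanSpace.single k (1 : ℝ)‖ = √(‖x‖ ^ 2 + 2 * x k * s + s ^ 2) := by
  rw [← Real.sqrt_sq (norm_nonneg _), norm_add_sq_real]
  congr 1
  simp [real_inner_smul_right, norm_smul, EuclideanSpace.inner_single_right]
  ring

lemma hasSecondDerivAt_norm_add_smul_single {m : ℕ} {x : EuclideanSpace ℝ (Fin m)} (k : Fin m)
    (hx : 0 < ‖x‖) :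
    HasSecondDerivAt (fun s : ℝ => ‖x + s • EuclideanSpace.single k (1 : ℝ)‖) (x k / ‖x‖)
      (1 / ‖x‖ - x k ^ 2 / ‖x‖ ^ 3) 0 := by
  simp only [norm_add_smul_single]
  have hq : HasSecondDerivAt (fun s : ℝ => ‖x‖ ^ 2 + 2 * x k * s + s ^ 2) (2 * x k) 2 0 := by
    refine ⟨fun s => 2 * x k + 2 * s, .of_forall fun s => ?_, by simp, ?_⟩
    · exact ((((hasDerivAt_id s).const_mul (2 * x k)).const_add (‖x‖ ^ 2)).add
        (hasDerivAt_pow 2 s)).congr_deriv (by simp)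
    · exact (((hasDerivAt_id (0 : ℝ)).const_mul 2).const_add (2 * x k)).congr_deriv (by simp)
  have hs : √(‖x‖ ^ 2 + 2 * x k * 0 + 0 ^ 2) = ‖x‖ := by
    simp
  have := (HasSecondDerivAt.sqrt (a := ‖x‖ ^ 2 + 2 * x k * 0 + 0 ^ 2) (by simp; positivity)).comp
    (f := fun s : ℝ => ‖x‖ ^ 2 + 2 * x k * s + s ^ 2) hq
  rw [hs] at this
  convert this using 1
  · field_simp
  · field_simp
    ring

/-- The Laplacian of the product of a radial function and a homogeneous harmonic function. -/
lemma lap3_radial_mul {n : ℕ} {H : EuclideanSpace ℝ (Fin 3) → ℝ} {x : EuclideanSpace ℝ (Fin 3)}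
    {F : ℝ → ℝ} {F₁ F₂ : ℝ} (hx : 0 < ‖x‖) (hH : ContDiff ℝ 2 H)
    (hhom : ∀ c : ℝ, H (c • x) = c ^ n * H x) (hharm : lap3 H x = 0)
    (hF : HasSecondDerivAt F F₁ F₂ ‖x‖) :
    lap3 (fun y => F ‖y‖ * H y) x = (F₂ + (2 * n + 2) / ‖x‖ * F₁) * H x := by
  have hh (k : Fin 3) : HasSecondDerivAt
      (fun s : ℝ => H (x + s • EuclideanSpace.single k (1 : ℝ)))
      (fderiv ℝ H x (EuclideanSpace.single k 1))
      (iteratedDeriv 2 (fun s : ℝ => H (x + s • EuclideanSpace.single k (1 : ℝ))) 0) 0 := by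
    have hc : ContDiff ℝ 2 fun s : ℝ => H (x + s • EuclideanSpace.single k (1 : ℝ)) := by
      fun_prop
    have h := hc.contDiffAt (x := 0).hasSecondDerivAt
    have hl : HasDerivAt (fun s : ℝ => x + s • EuclideanSpace.single k (1 : ℝ))
        (EuclideanSpace.single k 1) 0 := by
      simpa using ((hasDerivAt_id (0 : ℝ)).smul_const (EuclideanSpace.single k (1 : ℝ))).const_add x
    have hH' : HasFDerivAt H (fderiv ℝ H x) (x + (0 : ℝ) • EuclideanSpace.single k (1 : ℝ)) := by
      simpa using (hH.differentiable (by norm_num) x).hasFDerivAt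
    have h₁ := (hH'.comp_hasDerivAt 0 hl).deriv
    rw [h.iteratedDeriv_two, ← h₁]
    exact h
  have hterm (k : Fin 3) := ((HasSecondDerivAt.comp (g := F) (by simpa using hF)
    (hasSecondDerivAt_norm_add_smul_single k hx)).mul (hh k)).iteratedDeriv_two
  have hEuler := sum_coord_mul_fderiv_single (hH.differentiable (by norm_num) x) hhom
  have hnorm := EuclideanSpace.real_norm_sq_eq x
  unfold lap3 at hharm ⊢
  simp only [hterm]
  simp only [zero_smul, add_zero]
  simp only [Fin.sum_univ_three] at hharm hEuler hnorm ⊢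
  generalize fderiv ℝ H x (EuclideanSpace.single 0 1) = d0 at *
  generalize fderiv ℝ H x (EuclideanSpace.single 1 1) = d1 at *
  generalize fderiv ℝ H x (EuclideanSpace.single 2 1) = d2 at *
  generalize iteratedDeriv 2 (fun s : ℝ => H (x + s • EuclideanSpace.single 0 (1 : ℝ))) 0 = e0 at *
  generalize iteratedDeriv 2 (fun s : ℝ => H (x + s • EuclideanSpace.single 1 (1 : ℝ))) 0 = e1 at *
  generalize iteratedDeriv 2 (fun s : ℝ => H (x + s • EuclideanSpace.single 2 (1 : ℝ))) 0 = e2 at *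
  generalize ‖x‖ = r at *
  field_simp
  linear_combination (r ^ 3 * F r) * hharm + 2 * r ^ 2 * F₁ * hEuler
    - (F₂ * r * H x - F₁ * H x) * hnorm

/-- If `H` is a harmonic polynomial homogeneous of degree `n ≥ 1` and `Ψ` is a C²
solution of `(1 − s²)Ψ'' + n(n+1)Ψ = 0` on `(1,∞)` with `Ψ(1) = 0`, then
`φ(x,t) = Ψ(t/|x|) · H(x/|x|)` solves the wave equation for `t > |x| > 0` and vanishes
on the light cone. -/
theorem statement3
    (n : ℕ) (hn : 1 ≤ n)
    (H : EuclideanSpace ℝ (Fin 3) → ℝ)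
    (hHpoly : ∃ P : MvPolynomial (Fin 3) ℝ, P.IsHomogeneous n ∧
      ∀ x : EuclideanSpace ℝ (Fin 3), H x = MvPolynomial.eval x P)
    (hHharm : ∀ x : EuclideanSpace ℝ (Fin 3), lap3 H x = 0)
    (Ψ : ℝ → ℝ)
    (hΨC2 : ContDiffOn ℝ 2 Ψ (Set.Ici 1))
    (hΨode : ∀ s : ℝ, 1 < s →
      (1 - s ^ 2) * deriv (deriv Ψ) s + (n * (n + 1) : ℝ) * Ψ s = 0)
    (hΨ1 : Ψ 1 = 0)
    (φ : EuclideanSpace ℝ (Fin 3) → ℝ → ℝ)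
    (hφ : ∀ (x : EuclideanSpace ℝ (Fin 3)) (t : ℝ),
      φ x t = Ψ (t / ‖x‖) * H (‖x‖⁻¹ • x)) :
    (∀ (x : EuclideanSpace ℝ (Fin 3)) (t : ℝ), 0 < ‖x‖ → ‖x‖ < t →
      iteratedDeriv 2 (fun s => φ x s) t - lap3 (fun y => φ y t) x = 0) ∧
    (∀ x : EuclideanSpace ℝ (Fin 3), x ≠ 0 → φ x ‖x‖ = 0) := by
  obtain ⟨P, hP, hHP⟩ := hHpoly
  have hH : ContDiff ℝ 2 H := by
    rw [funext hHP]
    exact contDiff_eval_mvPolynomial P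
  have hhom (x : EuclideanSpace ℝ (Fin 3)) (c : ℝ) : H (c • x) = c ^ n * H x := by
    rw [hHP, hHP, ← hP.eval_smul']
    rfl
  refine ⟨fun x t hx hxt => ?_, fun x hx => ?_⟩
  · have hs : 1 < t / ‖x‖ := (one_lt_div hx).2 hxt
    have hΨ := (hΨC2.contDiffAt (Ici_mem_nhds hs)).hasSecondDerivAt
    have hode := hΨode _ hs
    have htime : iteratedDeriv 2 (fun s => φ x s) t =
        deriv (deriv Ψ) (t / ‖x‖) * ‖x‖⁻¹ ^ 2 * (‖x‖⁻¹ ^ n * H x) := by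
      have hg : ‖x‖⁻¹ * t = t / ‖x‖ := by ring
      have h := ((HasSecondDerivAt.comp (f := fun s => ‖x‖⁻¹ * s) (by rwa [hg])
        (HasSecondDerivAt.const_mul_id ‖x‖⁻¹)).mul
        (HasSecondDerivAt.const (‖x‖⁻¹ ^ n * H x))).iteratedDeriv_two
      have hφx : (fun s => φ x s) = fun s => Ψ (‖x‖⁻¹ * s) * (‖x‖⁻¹ ^ n * H x) := by
        funext s
        rw [hφ, hhom, inv_mul_eq_div]
      rw [hφx, h]
      ring
    have hF : HasSecondDerivAt (fun r => Ψ (t * r ^ (-1 : ℤ)) * r ^ (-(n : ℤ))) _ _ ‖x‖ :=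
      (HasSecondDerivAt.comp (f := fun r => t * r ^ (-1 : ℤ))
        (by rwa [zpow_neg_one, ← div_eq_mul_inv])
        ((HasSecondDerivAt.const t).mul (HasSecondDerivAt.zpow (-1) hx.ne'))).mul
        (HasSecondDerivAt.zpow (-(n : ℤ)) hx.ne')
    have hφt : (fun y => φ y t) = fun y => Ψ (t * ‖y‖ ^ (-1 : ℤ)) * ‖y‖ ^ (-(n : ℤ)) * H y := by
      funext y
      rw [hφ, hhom, zpow_neg_one, ← div_eq_mul_inv, zpow_neg, zpow_natCast, inv_pow, mul_assoc]
    rw [htime, hφt, lap3_radial_mul hx hH (hhom x) (hHharm x) hF]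
    have hr := hx.ne'
    have e₁ : ‖x‖ ^ (-(n : ℤ) - 1) = ‖x‖⁻¹ ^ n * ‖x‖⁻¹ := by
      rw [zpow_sub_one₀ hr, zpow_neg, zpow_natCast, inv_pow]
    have e₂ : ‖x‖ ^ (-(n : ℤ) - 2) = ‖x‖⁻¹ ^ n * ‖x‖⁻¹ ^ 2 := by
      rw [zpow_sub₀ hr, zpow_neg, zpow_natCast, inv_pow]
      simp [div_eq_mul_inv, zpow_ofNat]
    have e₀ : ‖x‖ ^ (-(n : ℤ)) = ‖x‖⁻¹ ^ n := by
      rw [zpow_neg, zpow_natCast, inv_pow]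
    have e₃ : ‖x‖ ^ ((-1 : ℤ) - 1) = ‖x‖⁻¹ ^ 2 := by
      rw [show ((-1 : ℤ) - 1) = -((2 : ℕ) : ℤ) by norm_num, zpow_neg, zpow_natCast, inv_pow]
    have e₄ : ‖x‖ ^ ((-1 : ℤ) - 2) = ‖x‖⁻¹ ^ 3 := by
      rw [show ((-1 : ℤ) - 2) = -((3 : ℕ) : ℤ) by norm_num, zpow_neg, zpow_natCast, inv_pow]
    rw [e₁, e₂, e₀, e₃, e₄, zpow_neg_one, ← div_eq_mul_inv t]
    push_cast
    generalize deriv (deriv Ψ) (t / ‖x‖) = p₂ at *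
    generalize deriv Ψ (t / ‖x‖) = p₁ at *
    generalize Ψ (t / ‖x‖) = p₀ at *
    rw [div_eq_mul_inv] at hode
    rw [div_eq_mul_inv]
    generalize ‖x‖⁻¹ = ρ at *
    linear_combination ρ ^ 2 * ρ ^ n * H x * hode
  · rw [hφ, div_self (norm_ne_zero_iff.2 hx), hΨ1, zero_mul]
end
end

section
/- Let n ≥ 1 be an integer, let H : ℝ³ → ℝ be a harmonic polynomial (ΔH = 0) homogeneous of degree n, let Pₙ denote the n-th Legendre polynomial, and set Q_{n+1}(s) = ∫₁ˢ Pₙ(y) dy. Then for every smooth function ω : ℝ → ℝ, the function φ(x,t) = H(x/|x|) · ∫₀^{t−|x|} ω(τ) Q_{n+1}((t−τ)/|x|) dτ, defined for t ≥ |x| > 0, satisfies the wave equation ∂ₜₜφ − Δφ = 0 for t > |x| > 0 and vanishes on the light cone: φ(x,|x|) = 0 for x ≠ 0. -/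
noncomputable section

/-- The `n`-th Legendre polynomial via Rodrigues' formula:
`Pₙ(y) = (1/(2ⁿ n!)) dⁿ/dyⁿ (y² − 1)ⁿ`. -/
def legendreFn (n : ℕ) (y : ℝ) : ℝ :=
  (1 / (2 ^ n * n.factorial)) * iteratedDeriv n (fun z : ℝ => (z ^ 2 - 1) ^ n) y

/-- `Q_{n+1}(s) = ∫₁ˢ Pₙ(y) dy`. -/
def Qfun (n : ℕ) (s : ℝ) : ℝ := ∫ y in (1:ℝ)..s, legendreFn n y

open Polynomial in
/-- Rodrigues' formula as a polynomial. -/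
def legendrePoly (n : ℕ) : ℝ[X] :=
  C (1 / (2 ^ n * (n.factorial : ℝ))) * derivative^[n] ((X ^ 2 - 1) ^ n)

open Polynomial in
theorem Polynomial.iteratedDeriv_eval (p : ℝ[X]) (n : ℕ) :
    iteratedDeriv n (fun z : ℝ => p.eval z) = fun z => (derivative^[n] p).eval z := by
  induction n with
  | zero => simp
  | succ k ih =>
    rw [iteratedDeriv_succ, ih]
    funext z
    rw [Polynomial.deriv, Function.iterate_succ_apply']

open Polynomial in
theorem legendreFn_eq_eval (n : ℕ) (y : ℝ) : legendreFn n y = (legendrePoly n).eval y := by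
  have h : (fun z : ℝ => (z ^ 2 - 1) ^ n) = fun z => ((X ^ 2 - 1 : ℝ[X]) ^ n).eval z := by
    funext z
    simp
  rw [legendreFn, h, Polynomial.iteratedDeriv_eval]
  simp [legendrePoly]

open Polynomial in
/-- The Legendre equation in divergence form. -/
theorem derivative_mul_derivative_legendrePoly (n : ℕ) :
    derivative ((X ^ 2 - 1) * derivative (legendrePoly n)) =
      C ((n : ℝ) * (n + 1)) * legendrePoly n := by
  set f : ℝ[X] := (X ^ 2 - 1) ^ n with hf
  have h1 : (X ^ 2 - 1) * derivative f = C (2 * (n : ℝ)) * X * f := by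
    rcases n with _ | m
    · simp [hf]
    · rw [hf, derivative_pow_succ]
      simp only [derivative_sub, derivative_X_pow, derivative_one, map_mul]
      push_cast
      simp only [map_add, map_natCast, map_one, map_ofNat]
      ring
  have h2 := congrArg derivative h1
  simp only [derivative_mul, derivative_sub, derivative_X_pow, derivative_one, derivative_C,
    derivative_X] at h2
  have h3 : derivative^[2] f * X ^ 2 - derivative^[2] f =
      C (2 * (n : ℝ) - 2) * (derivative f * X) + C (2 * (n : ℝ)) * f := by
    simp only [Function.iterate_succ_apply, Function.iterate_zero_apply]
    simp only [map_sub, map_mul, map_natCast, map_ofNat] at h2 ⊢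
    push_cast at h2
    linear_combination h2
  have h4 := congrArg (derivative^[n]) h3
  rw [iterate_derivative_sub, iterate_derivative_derivative_mul_X_sq, iterate_map_add,
    iterate_derivative_C_mul, iterate_derivative_C_mul, iterate_derivative_derivative_mul_X] at h4
  have e2 : derivative^[n] (derivative^[2] f) = derivative (derivative (derivative^[n] f)) := by
    rw [← Function.iterate_add_apply, add_comm, Function.iterate_add_apply]
    rfl
  have e1 : derivative^[n + 1] f = derivative (derivative^[n] f) :=
    Function.iterate_succ_apply' _ _ _
  have e3 : derivative^[n + 2] f = derivative (derivative (derivative^[n] f)) := by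
    rw [Function.iterate_succ_apply', e1]
  have hc : ((n * (n - 1) : ℕ) : ℝ[X]) = n * (n - 1) := by
    rcases n with _ | m <;> simp
  simp only [nsmul_eq_mul, hc] at h4
  rw [e2, e3, e1] at h4
  rw [legendrePoly, ← hf, derivative_C_mul, mul_left_comm, derivative_C_mul, derivative_mul]
  simp only [derivative_sub, derivative_X_pow, derivative_one]
  push_cast at h4 ⊢
  simp only [map_sub, map_add, map_mul, map_natCast, map_ofNat, map_one] at h4 ⊢
  linear_combination C (1 / (2 ^ n * (n.factorial : ℝ))) * h4

open Polynomial in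
theorem Qfun_eq_eval {n : ℕ} (hn : 1 ≤ n) :
    ∃ q : ℝ[X], derivative q = legendrePoly n ∧ q.eval 1 = 0 ∧
      C ((n : ℝ) * (n + 1)) * q = (X ^ 2 - 1) * derivative (legendrePoly n) ∧
      ∀ s, Qfun n s = q.eval s := by
  have hn0 : (n : ℝ) * (n + 1) ≠ 0 := by positivity
  set q : ℝ[X] := C (((n : ℝ) * (n + 1))⁻¹) * ((X ^ 2 - 1) * derivative (legendrePoly n)) with hq
  have hd : derivative q = legendrePoly n := by
    rw [hq, derivative_C_mul, derivative_mul_derivative_legendrePoly, ← mul_assoc, ← C_mul,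
      inv_mul_cancel₀ hn0, C_1, one_mul]
  have h1 : q.eval 1 = 0 := by simp [hq]
  refine ⟨q, hd, h1, ?_, fun s => ?_⟩
  · rw [hq, ← mul_assoc, ← C_mul, mul_inv_cancel₀ hn0, C_1, one_mul]
  · rw [Qfun, intervalIntegral.integral_eq_sub_of_hasDerivAt (f := fun y => q.eval y), h1, sub_zero]
    · intro y _
      rw [legendreFn_eq_eval, ← hd]
      exact q.hasDerivAt y
    · rw [show legendreFn n = fun y => (legendrePoly n).eval y from
        funext (legendreFn_eq_eval n)]
      exact (legendrePoly n).continuous.intervalIntegrable _ _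

open Polynomial in
/-- The integral `∫₀^{t-r} ω(τ) q((t-τ)/r) dτ`. -/
def coneIntegral (ω : ℝ → ℝ) (q : ℝ[X]) (r t : ℝ) : ℝ :=
  ∫ τ in (0 : ℝ)..(t - r), ω τ * q.eval ((t - τ) / r)

open Polynomial in
theorem intervalIntegrable_coneIntegral {ω : ℝ → ℝ} (hω : Continuous ω) (q : ℝ[X])
    (r t a b : ℝ) :
    IntervalIntegrable (fun τ => ω τ * q.eval ((t - τ) / r)) MeasureTheory.volume a b :=
  (hω.mul (q.continuous.comp (by fun_prop))).intervalIntegrable _ _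

open Polynomial in
theorem coneIntegral_add {ω : ℝ → ℝ} (hω : Continuous ω) (p q : ℝ[X]) (r t : ℝ) :
    coneIntegral ω (p + q) r t = coneIntegral ω p r t + coneIntegral ω q r t := by
  simp only [coneIntegral, eval_add, mul_add]
  exact intervalIntegral.integral_add (intervalIntegrable_coneIntegral hω p r t _ _)
    (intervalIntegrable_coneIntegral hω q r t _ _)

open Polynomial in
theorem coneIntegral_C_mul (ω : ℝ → ℝ) (a : ℝ) (q : ℝ[X]) (r t : ℝ) :
    coneIntegral ω (C a * q) r t = a * coneIntegral ω q r t := by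
  simp only [coneIntegral, eval_mul, eval_C, ← intervalIntegral.integral_const_mul]
  congr 1
  funext τ
  ring

open Polynomial in
theorem coneIntegral_X_mul {ω : ℝ → ℝ} (hω : Continuous ω) (q : ℝ[X]) (r t : ℝ) :
    coneIntegral ω (X * q) r t =
      (t * coneIntegral ω q r t - coneIntegral (fun τ => τ * ω τ) q r t) / r := by
  simp only [coneIntegral]
  rw [← intervalIntegral.integral_const_mul, ← intervalIntegral.integral_sub,
    ← intervalIntegral.integral_div]
  · congr 1
    funext τ
    simp only [eval_mul, eval_X]
    ring
  · exact (intervalIntegrable_coneIntegral hω q r t _ _).const_mul t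
  · exact intervalIntegrable_coneIntegral (continuous_id.mul hω) q r t _ _

open Polynomial in
/-- Leibniz' rule for `coneIntegral` along a differentiable curve `s ↦ (r s, t s)`. -/
theorem hasDerivAt_coneIntegral {ω : ℝ → ℝ} (hω : Continuous ω) (q : ℝ[X]) {r t : ℝ → ℝ}
    {r' t' s : ℝ} (hr : HasDerivAt r r' s) (ht : HasDerivAt t t' s) (hr0 : r s ≠ 0) :
    HasDerivAt (fun s => coneIntegral ω q (r s) (t s))
      (ω (t s - r s) * q.eval 1 * (t' - r') +
        (t' * coneIntegral ω (derivative q) (r s) (t s) -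
          r' * coneIntegral ω (X * derivative q) (r s) (t s)) / r s) s := by
  have hC : ∀ (ω : ℝ → ℝ), Continuous ω → ∀ a : ℝ,
      HasDerivAt (fun s => coneIntegral ω (C a) (r s) (t s))
        (ω (t s - r s) * a * (t' - r')) s := by
    intro ω hω a
    simp only [coneIntegral, eval_C]
    have hωa : Continuous fun τ => ω τ * a := hω.mul continuous_const
    exact (intervalIntegral.integral_hasDerivAt_right (hωa.intervalIntegrable _ _)
      hωa.stronglyMeasurable.stronglyMeasurableAtFilter hωa.continuousAt).comp s (ht.sub hr)
  have h0 : ∀ ω r t, coneIntegral ω 0 r t = 0 := by simp [coneIntegral]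
  induction q using Polynomial.induction_on' generalizing ω with
  | add p q hp hq =>
    simp only [coneIntegral_add hω, eval_add, derivative_add, mul_add]
    refine ((hp hω).fun_add (hq hω)).congr_deriv ?_
    ring
  | monomial k a =>
    induction k generalizing ω with
    | zero =>
      simpa [h0] using hC ω hω a
    | succ k ih =>
      have hω' : Continuous fun τ => τ * ω τ := continuous_id.mul hω
      have hm : monomial (k + 1) a = X * monomial k a := by rw [X_mul_monomial]
      have e : (fun s => coneIntegral ω (monomial (k + 1) a) (r s) (t s)) = fun s =>
          (t s * coneIntegral ω (monomial k a) (r s) (t s) -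
            coneIntegral (fun τ => τ * ω τ) (monomial k a) (r s) (t s)) / r s := by
        funext s
        rw [hm, coneIntegral_X_mul hω]
      rw [e]
      refine (((ht.fun_mul (ih hω)).fun_sub (ih hω')).fun_div hr hr0).congr_deriv ?_
      have d : derivative (monomial (k + 1) a) = monomial k a + X * derivative (monomial k a) := by
        rw [hm, derivative_mul, derivative_X, one_mul]
      rw [d, hm]
      simp only [mul_add, coneIntegral_add hω, coneIntegral_X_mul hω, coneIntegral_X_mul hω',
        eval_mul, eval_X]
      field_simp
      ring

/-- Derivative of a polynomial along a coordinate line. -/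
theorem MvPolynomial.hasDerivAt_eval_add_smul_single (P : MvPolynomial (Fin 3) ℝ)
    (x : EuclideanSpace ℝ (Fin 3)) (k : Fin 3) (s : ℝ) :
    HasDerivAt (fun s : ℝ => eval (x + s • EuclideanSpace.single k (1 : ℝ)) P)
      (eval (x + s • EuclideanSpace.single k (1 : ℝ)) (pderiv k P)) s := by
  induction P using MvPolynomial.induction_on with
  | C a => simpa using hasDerivAt_const s a
  | add p q hp hq => simpa using hp.fun_add hq
  | mul_X p i hp =>
    have hX : HasDerivAt (fun s : ℝ => eval (x + s • EuclideanSpace.single k (1 : ℝ)) (X i))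
        (eval (x + s • EuclideanSpace.single k (1 : ℝ)) (pderiv k (X i))) s := by
      by_cases h : i = k
      · subst h
        simpa using (hasDerivAt_id s).const_add (x i)
      · simpa [h, pderiv_X_of_ne (Ne.symm h), pderiv_X_of_ne h] using hasDerivAt_const s (x i)
    simp only [map_mul, Derivation.leibniz, map_add, smul_eq_mul]
    refine (hp.fun_mul hX).congr_deriv ?_
    ring

theorem hasDerivAt_norm_add_smul_single (x : EuclideanSpace ℝ (Fin 3)) (k : Fin 3) (s : ℝ)
    (h : x + s • EuclideanSpace.single k (1 : ℝ) ≠ 0) :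
    HasDerivAt (fun s : ℝ => ‖x + s • EuclideanSpace.single k (1 : ℝ)‖)
      ((x k + s) / ‖x + s • EuclideanSpace.single k (1 : ℝ)‖) s := by
  have h1 : HasDerivAt (fun s : ℝ => x + s • EuclideanSpace.single k (1 : ℝ))
      (EuclideanSpace.single k (1 : ℝ)) s := by
    simpa using ((hasDerivAt_id s).smul_const (EuclideanSpace.single k (1 : ℝ))).const_add x
  have h2 := h1.norm_sq.sqrt (by positivity)
  simp only [Real.sqrt_sq (norm_nonneg _)] at h2
  refine h2.congr_deriv ?_
  rw [real_inner_comm, EuclideanSpace.inner_single_left]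
  simp
  ring

theorem iteratedDeriv_two_eq {f f' : ℝ → ℝ} {f'' x : ℝ}
    (hf : ∀ᶠ s in nhds x, HasDerivAt f (f' s) s) (hf' : HasDerivAt f' f'' x) :
    iteratedDeriv 2 f x = f'' := by
  rw [iteratedDeriv_succ, iteratedDeriv_one]
  have h : deriv f =ᶠ[nhds x] f' := hf.mono fun s hs => hs.deriv
  rw [h.deriv_eq, hf'.deriv]

/-- The Laplacian of a homogeneous harmonic polynomial times a radial function. -/
theorem lap3_mul_radial {n : ℕ} {P : MvPolynomial (Fin 3) ℝ} (hP : P.IsHomogeneous n)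
    {x : EuclideanSpace ℝ (Fin 3)} (hx : x ≠ 0)
    (hharm : lap3 (fun y => MvPolynomial.eval y P) x = 0) {G G' : ℝ → ℝ} {G'' : ℝ}
    (hG : ∀ ρ, 0 < ρ → HasDerivAt G (G' ρ) ρ) (hG' : HasDerivAt G' G'' ‖x‖) :
    lap3 (fun y => MvPolynomial.eval y P * G ‖y‖) x =
      MvPolynomial.eval x P * (G'' + 2 * (n + 1) / ‖x‖ * G' ‖x‖) := by
  have hr : 0 < ‖x‖ := norm_pos_iff.mpr hx
  have hk : ∀ k : Fin 3, iteratedDeriv 2 (fun s : ℝ =>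
      MvPolynomial.eval (x + s • EuclideanSpace.single k (1 : ℝ)) P *
        G ‖x + s • EuclideanSpace.single k (1 : ℝ)‖) 0 =
      MvPolynomial.eval x (MvPolynomial.pderiv k (MvPolynomial.pderiv k P)) * G ‖x‖ +
      2 * (x k * MvPolynomial.eval x (MvPolynomial.pderiv k P)) * (G' ‖x‖ / ‖x‖) +
      MvPolynomial.eval x P * (G'' * x k ^ 2 / ‖x‖ ^ 2 + G' ‖x‖ * (1 / ‖x‖ - x k ^ 2 / ‖x‖ ^ 3)) := by
    intro k
    have hne : ∀ᶠ s : ℝ in nhds 0, x + s • EuclideanSpace.single k (1 : ℝ) ≠ 0 := by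
      have hc : ContinuousAt (fun s : ℝ => x + s • EuclideanSpace.single k (1 : ℝ)) 0 := by
        fun_prop
      exact hc.eventually_ne (by simpa using hx)
    have hx0 : x + (0 : ℝ) • EuclideanSpace.single k (1 : ℝ) = x := by simp
    have hP' := fun (Q : MvPolynomial (Fin 3) ℝ) s => Q.hasDerivAt_eval_add_smul_single x k s
    have hN := hasDerivAt_norm_add_smul_single x k 0 (by rwa [hx0])
    refine iteratedDeriv_two_eq (hne.mono fun s hs => (hP' P s).mul
      ((hG _ (norm_pos_iff.mpr hs)).comp s (hasDerivAt_norm_add_smul_single x k s hs))) ?_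
    have hG0 : HasDerivAt G (G' ‖x + (0 : ℝ) • EuclideanSpace.single k (1 : ℝ)‖)
      ‖x + (0 : ℝ) • EuclideanSpace.single k (1 : ℝ)‖ := by rw [hx0]; exact hG _ hr
    have hG0' : HasDerivAt G' G'' ‖x + (0 : ℝ) • EuclideanSpace.single k (1 : ℝ)‖ := by rwa [hx0]
    have hN0 : ‖x + (0 : ℝ) • EuclideanSpace.single k (1 : ℝ)‖ ≠ 0 := by rw [hx0]; exact hr.ne'
    have := ((hP' (MvPolynomial.pderiv k P) 0).mul (hG0.comp 0 hN)).add ((hP' P 0).mul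
      ((hG0'.comp 0 hN).mul (((hasDerivAt_id (0 : ℝ)).const_add (x k)).div hN hN0)))
    refine this.congr_deriv ?_
    simp only [Function.comp_apply, Pi.mul_apply, Pi.div_apply, hx0, add_zero, id]
    field_simp
    ring
  have hlap : ∑ k : Fin 3, MvPolynomial.eval x
      (MvPolynomial.pderiv k (MvPolynomial.pderiv k P)) = 0 := by
    rw [← hharm, lap3]
    refine Finset.sum_congr rfl fun k _ => (iteratedDeriv_two_eq (Filter.Eventually.of_forall
      fun s => P.hasDerivAt_eval_add_smul_single x k s) ?_).symm
    simpa using (MvPolynomial.pderiv k P).hasDerivAt_eval_add_smul_single x k 0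
  have heuler : ∑ k : Fin 3, x k * MvPolynomial.eval x (MvPolynomial.pderiv k P) =
      n * MvPolynomial.eval x P := by
    simpa using congrArg (MvPolynomial.eval (x : Fin 3 → ℝ)) hP.sum_X_mul_pderiv
  have hnorm : ‖x‖ ^ 2 = ∑ k : Fin 3, x k ^ 2 := EuclideanSpace.real_norm_sq_eq x
  simp only [lap3, hk]
  have hsum : ∑ k : Fin 3, x k ^ 2 / ‖x‖ ^ 2 = 1 := by
    rw [← Finset.sum_div, ← hnorm, div_self (by positivity)]
  simp only [Fin.sum_univ_three] at hlap heuler hsum ⊢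
  linear_combination G ‖x‖ * hlap + 2 * (G' ‖x‖ / ‖x‖) * heuler +
    MvPolynomial.eval x P * (G'' - G' ‖x‖ / ‖x‖) * hsum

theorem hasDerivAt_inv_pow (n : ℕ) {ρ : ℝ} (hρ : ρ ≠ 0) :
    HasDerivAt (fun ρ : ℝ => (ρ ^ n)⁻¹) ((ρ ^ n)⁻¹ * (-n / ρ)) ρ := by
  refine ((hasDerivAt_pow n ρ).fun_inv (pow_ne_zero n hρ)).congr_deriv ?_
  rcases n with _ | m
  · simp
  · rw [Nat.add_sub_cancel]
    field_simp
    ring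

theorem MvPolynomial.IsHomogeneous.eval_real_smul {n : ℕ} {P : MvPolynomial (Fin 3) ℝ}
    (hP : P.IsHomogeneous n) (c : ℝ) (x : Fin 3 → ℝ) :
    eval (c • x) P = c ^ n * eval x P := by
  rw [eval_eq, eval_eq, Finset.mul_sum]
  refine Finset.sum_congr rfl fun d hd => ?_
  have hdeg : ∑ i ∈ d.support, d i = n := by
    rw [← hP.degree_eq_sum_deg_support hd]
  simp only [Pi.smul_apply, smul_eq_mul, mul_pow, Finset.prod_mul_distrib,
    Finset.prod_pow_eq_pow_sum, hdeg]
  ring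

/-- For a harmonic polynomial `H` homogeneous of degree `n ≥ 1` and any smooth `ω`,
`φ(x,t) = H(x/|x|) ∫₀^{t−|x|} ω(τ) Q_{n+1}((t−τ)/|x|) dτ` solves the wave equation for
`t > |x| > 0` and vanishes on the light cone. -/
theorem statement5
    (n : ℕ) (hn : 1 ≤ n)
    (H : EuclideanSpace ℝ (Fin 3) → ℝ)
    (hHpoly : ∃ P : MvPolynomial (Fin 3) ℝ, P.IsHomogeneous n ∧
      ∀ x : EuclideanSpace ℝ (Fin 3), H x = MvPolynomial.eval x P)
    (hHharm : ∀ x : EuclideanSpace ℝ (Fin 3), lap3 H x = 0)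
    (ω : ℝ → ℝ) (hω : ContDiff ℝ (⊤ : ℕ∞) ω)
    (φ : EuclideanSpace ℝ (Fin 3) → ℝ → ℝ)
    (hφ : ∀ (x : EuclideanSpace ℝ (Fin 3)) (t : ℝ),
      φ x t = H (‖x‖⁻¹ • x) *
        ∫ τ in (0:ℝ)..(t - ‖x‖), ω τ * Qfun n ((t - τ) / ‖x‖)) :
    (∀ (x : EuclideanSpace ℝ (Fin 3)) (t : ℝ), 0 < ‖x‖ → ‖x‖ < t →
      iteratedDeriv 2 (fun s => φ x s) t - lap3 (fun y => φ y t) x = 0) ∧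
    (∀ x : EuclideanSpace ℝ (Fin 3), x ≠ 0 → φ x ‖x‖ = 0) := by
  obtain ⟨P, hP, hHP⟩ := hHpoly
  obtain ⟨q, hqd, hq1, hqODE, hQ⟩ := Qfun_eq_eval hn
  obtain rfl : H = fun y : EuclideanSpace ℝ (Fin 3) => MvPolynomial.eval y P := funext hHP
  have hφ' : ∀ y t, φ y t =
      MvPolynomial.eval y P * ((‖y‖ ^ n)⁻¹ * coneIntegral ω q ‖y‖ t) := by
    intro y t
    simp only [hφ, hQ]
    rw [WithLp.ofLp_smul, hP.eval_real_smul, inv_pow, coneIntegral]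
    ring
  refine ⟨fun x t hx _ => ?_, fun x _ => by rw [hφ]; simp⟩
  have hωc := hω.continuous
  have hr : ‖x‖ ≠ 0 := hx.ne'
  set p := legendrePoly n with hp
  have hA : ∀ ρ : ℝ, 0 < ρ → HasDerivAt (fun ρ => coneIntegral ω q ρ t)
      (-coneIntegral ω (Polynomial.X * p) ρ t / ρ) ρ := fun ρ hρ => by
    have := hasDerivAt_coneIntegral hωc q (hasDerivAt_id ρ) (hasDerivAt_const ρ t) hρ.ne'
    refine this.congr_deriv ?_
    simp [hq1, hqd]
  have hG : ∀ ρ : ℝ, 0 < ρ → HasDerivAt (fun ρ => (ρ ^ n)⁻¹ * coneIntegral ω q ρ t)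
      ((ρ ^ n)⁻¹ * (-(n * coneIntegral ω q ρ t + coneIntegral ω (Polynomial.X * p) ρ t) / ρ)) ρ :=
    fun ρ hρ => ((hasDerivAt_inv_pow n hρ.ne').fun_mul (hA ρ hρ)).congr_deriv (by ring)
  have hA1 := hasDerivAt_coneIntegral hωc (Polynomial.X * p) (hasDerivAt_id ‖x‖)
    (hasDerivAt_const ‖x‖ t) hr
  have hG' := (hasDerivAt_inv_pow n hr).fun_mul
    ((((hA ‖x‖ hx).const_mul (n : ℝ)).fun_add hA1).fun_neg.fun_div (hasDerivAt_id ‖x‖) hr)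
  have hlap := lap3_mul_radial hP (norm_pos_iff.mp hx) (hHharm x) hG hG'
  have hT : ∀ u, HasDerivAt (fun u => φ x u) (MvPolynomial.eval x P *
      ((‖x‖ ^ n)⁻¹ * (coneIntegral ω p ‖x‖ u / ‖x‖))) u := fun u => by
    simp only [hφ']
    have := hasDerivAt_coneIntegral hωc q (hasDerivAt_const u ‖x‖) (hasDerivAt_id u) hr
    refine ((this.const_mul _).const_mul _).congr_deriv ?_
    simp [hq1, hqd]
  have hT' := (((hasDerivAt_coneIntegral hωc p (hasDerivAt_const t ‖x‖) (hasDerivAt_id t)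
    hr).div_const ‖x‖).const_mul (‖x‖ ^ n)⁻¹).const_mul (MvPolynomial.eval x P)
  rw [iteratedDeriv_two_eq (Filter.Eventually.of_forall hT) hT']
  simp only [hφ']
  rw [hlap]
  have hODE : (n : ℝ) * (n + 1) * coneIntegral ω q ‖x‖ t +
      coneIntegral ω (Polynomial.derivative p) ‖x‖ t =
        coneIntegral ω (Polynomial.X * (Polynomial.X * Polynomial.derivative p)) ‖x‖ t := by
    rw [← coneIntegral_C_mul, hqODE, ← coneIntegral_add hωc]
    congr 1
    ring
  have hXX : coneIntegral ω (Polynomial.X * Polynomial.derivative (Polynomial.X * p)) ‖x‖ t =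
      coneIntegral ω (Polynomial.X * p) ‖x‖ t +
        ((n : ℝ) * (n + 1) * coneIntegral ω q ‖x‖ t +
          coneIntegral ω (Polynomial.derivative p) ‖x‖ t) := by
    rw [hODE, ← coneIntegral_add hωc]
    congr 1
    simp only [Polynomial.derivative_mul, Polynomial.derivative_X]
    ring
  simp only [id, hXX, Polynomial.eval_mul, Polynomial.eval_X]
  field_simp
  ring
end
end
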